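/- For every λσ-term t containing no ↑, the σ-normal form of ⇑₀¹(t) equals the σ-normal form of t[↑]: σ(⇑₀¹(t)) = σ(t[↑]). More generally, for every such t and every i ≥ 0, σ(⇑ᵢ¹(t)) = σ(t[⇑ⁱ(↑)]), where ⇑(s) denotes 1·(s∘↑). -/

import Mathlib

namespace LambdaSigma

/-- Simple types. -/
inductive Ty : Type
  | base : Ty
  | arrow : Ty → Ty → Ty

mutual
/-- Terms of the λσ-calculus: `one` is the index 1, plus application,
abstraction and closure `t[s]`. -/
inductive Tm : Type
  | one : Tm
  | app : Tm → Tm → Tm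
  | lam : Tm → Tm
  | sub : Tm → Sb → Tm

/-- Substitutions of λσ: `id`, `↑`, `t·s` and `s∘s'`. -/
inductive Sb : Type
  | id : Sb
  | shift : Sb
  | cons : Tm → Sb → Sb
  | comp : Sb → Sb → Sb
end

/-- The de Bruijn index `k+1`, following the convention `n+1 = n[↑]`:
`idx k` is the term representing the index `k+1`. -/
def idx : ℕ → Tm
  | 0 => .one
  | k + 1 => .sub (idx k) .shift

/-- Recognize the terms which are de Bruijn indices: `toIdx? t = some k`
iff `t = idx k` (i.e. `t` is the index `k+1`). -/
def toIdx? : Tm → Option ℕ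
  | .one => some 0
  | .sub t .shift => (toIdx? t).map (· + 1)
  | _ => none

mutual
/-- The re-indexing function `⇑ᵢʲ` on terms (indices being treated as
atomic constants): `⇑ᵢʲ(n) = n+j` if `n > i`, `n` otherwise, homomorphic on
applications, `⇑ᵢʲ(λt) = λ⇑_{i+1}ʲ(t)`, and `⇑ᵢʲ(t[s]) = ⇑_{i'}ʲ(t)[s']`
where `(i',s') = ⇑ᵢʲ(s)`. -/
def upT (i j : ℕ) : Tm → Tm
  | .one => if 0 < i then .one else idx j
  | .app t u => .app (upT i j t) (upT i j u)
  | .lam t => .lam (upT (i + 1) j t)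
  | .sub t s =>
      match toIdx? (.sub t s) with
      | some k => if i ≤ k then idx (k + j) else idx k
      | none =>
          let p := upS i j s
          .sub (upT p.1 j t) p.2

/-- The re-indexing function `⇑ᵢʲ` on substitutions, returning a pair of an
integer and a substitution. -/
def upS (i j : ℕ) : Sb → ℕ × Sb
  | .id => (i, .id)
  | .shift => (i, .shift)
  | .cons t s =>
      let p := upS i j s
      (p.1 + 1, .cons (upT i j t) p.2)
  | .comp s1 s2 =>
      let p2 := upS i j s2
      let p1 := upS p2.1 j s1
      (p1.1, .comp p1.2 p2.2)
end

/-- Substitution-free terms (de Bruijn indices being treated as atomic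
constants containing no substitutions). -/
inductive Pure : Tm → Prop
  | idx (n : ℕ) : Pure (idx n)
  | app {t u : Tm} : Pure t → Pure u → Pure (.app t u)
  | lam {t : Tm} : Pure t → Pure (.lam t)

mutual
/-- The simple typing system of λσ: `TypT Γ t A` is `Γ ⊢ t : A`. -/
inductive TypT : List Ty → Tm → Ty → Prop
  | one {Γ : List Ty} {A : Ty} : TypT (A :: Γ) .one A
  | app {Γ : List Ty} {t u : Tm} {A B : Ty} :
      TypT Γ t (.arrow B A) → TypT Γ u B → TypT Γ (.app t u) A
  | lam {Γ : List Ty} {t : Tm} {A B : Ty} :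
      TypT (B :: Γ) t A → TypT Γ (.lam t) (.arrow B A)
  | sub {Γ Γ' : List Ty} {t : Tm} {s : Sb} {A : Ty} :
      TypS Γ s Γ' → TypT Γ' t A → TypT Γ (.sub t s) A

/-- Typing of substitutions: `TypS Γ s Γ'` is `Γ ⊢ s ▷ Γ'`. -/
inductive TypS : List Ty → Sb → List Ty → Prop
  | id {Γ : List Ty} : TypS Γ .id Γ
  | shift {Γ : List Ty} {A : Ty} : TypS (A :: Γ) .shift Γ
  | cons {Γ Γ' : List Ty} {t : Tm} {s : Sb} {A : Ty} :
      TypT Γ t A → TypS Γ s Γ' → TypS Γ (.cons t s) (A :: Γ')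
  | comp {Γ Γ' Γ'' : List Ty} {s s' : Sb} :
      TypS Γ s' Γ'' → TypS Γ'' s Γ' → TypS Γ (.comp s s') Γ'
end

-- Sizes used to define `Ateb` by well-founded recursion.
mutual
def szT : Tm → ℕ
  | .one => 1
  | .app t u => szT t + szT u + 1
  | .lam t => szT t + 1
  | .sub t s => szT t + szS s + 1
def szS : Sb → ℕ
  | .id => 1
  | .shift => 1
  | .cons t s => szT t + szS s + 1
  | .comp s s' => szS s + szS s' + 2
end

theorem szT_pos : ∀ t : Tm, 0 < szT t := by
  intro t; cases t <;> simp [szT]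

/-- The expansion `Ateb` from λσ-terms to substitution-free terms. -/
def Ateb : Tm → Tm
  | .one => .one
  | .app t u => .app (Ateb t) (Ateb u)
  | .lam t => .lam (Ateb t)
  | .sub t .id => Ateb t
  | .sub t .shift => upT 0 1 (Ateb t)
  | .sub t (.comp s s') => Ateb (.sub (.sub t s) s')
  | .sub t (.cons t' s) => .app (Ateb (.sub (.lam t) s)) (Ateb t')
termination_by t => szT t
decreasing_by
  all_goals simp [szT, szS]
  all_goals first
    | omega
    | (have := szT_pos t'; omega)

mutual
/-- The σ-rules of λσ on terms (all the rules except `B`), closed under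
arbitrary contexts. -/
inductive SStep : Tm → Tm → Prop
  | app_s {t u : Tm} {s : Sb} :
      SStep (.sub (.app t u) s) (.app (.sub t s) (.sub u s))
  | lam_s {t : Tm} {s : Sb} :
      SStep (.sub (.lam t) s) (.lam (.sub t (.cons .one (.comp s .shift))))
  | varid : SStep (.sub .one .id) .one
  | varcons {t : Tm} {s : Sb} : SStep (.sub .one (.cons t s)) t
  | clos {t : Tm} {s s' : Sb} : SStep (.sub (.sub t s) s') (.sub t (.comp s s'))
  | appl {t t' u : Tm} : SStep t t' → SStep (.app t u) (.app t' u)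
  | appr {t u u' : Tm} : SStep u u' → SStep (.app t u) (.app t u')
  | lam {t t' : Tm} : SStep t t' → SStep (.lam t) (.lam t')
  | subt {t t' : Tm} {s : Sb} : SStep t t' → SStep (.sub t s) (.sub t' s)
  | subs {t : Tm} {s s' : Sb} : SStepS s s' → SStep (.sub t s) (.sub t s')

/-- The σ-rules on substitutions. -/
inductive SStepS : Sb → Sb → Prop
  | idl {s : Sb} : SStepS (.comp .id s) s
  | shiftid : SStepS (.comp .shift .id) .shift
  | shiftcons {t : Tm} {s : Sb} : SStepS (.comp .shift (.cons t s)) s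
  | mapr {t : Tm} {s s' : Sb} :
      SStepS (.comp (.cons t s) s') (.cons (.sub t s') (.comp s s'))
  | assoc {s1 s2 s3 : Sb} :
      SStepS (.comp (.comp s1 s2) s3) (.comp s1 (.comp s2 s3))
  | consl {t t' : Tm} {s : Sb} : SStep t t' → SStepS (.cons t s) (.cons t' s)
  | consr {t : Tm} {s s' : Sb} : SStepS s s' → SStepS (.cons t s) (.cons t s')
  | compl {s1 s1' s2 : Sb} : SStepS s1 s1' → SStepS (.comp s1 s2) (.comp s1' s2)
  | compr {s1 s2 s2' : Sb} : SStepS s2 s2' → SStepS (.comp s1 s2) (.comp s1 s2')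
end

mutual
/-- The rule `B` of λσ, closed under arbitrary contexts. -/
inductive BStep : Tm → Tm → Prop
  | beta {t u : Tm} : BStep (.app (.lam t) u) (.sub t (.cons u .id))
  | appl {t t' u : Tm} : BStep t t' → BStep (.app t u) (.app t' u)
  | appr {t u u' : Tm} : BStep u u' → BStep (.app t u) (.app t u')
  | lam {t t' : Tm} : BStep t t' → BStep (.lam t) (.lam t')
  | subt {t t' : Tm} {s : Sb} : BStep t t' → BStep (.sub t s) (.sub t' s)
  | subs {t : Tm} {s s' : Sb} : BStepS s s' → BStep (.sub t s) (.sub t s')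

/-- The rule `B` inside substitutions. -/
inductive BStepS : Sb → Sb → Prop
  | consl {t t' : Tm} {s : Sb} : BStep t t' → BStepS (.cons t s) (.cons t' s)
  | consr {t : Tm} {s s' : Sb} : BStepS s s' → BStepS (.cons t s) (.cons t s')
  | compl {s1 s1' s2 : Sb} : BStepS s1 s1' → BStepS (.comp s1 s2) (.comp s1' s2)
  | compr {s1 s2 s2' : Sb} : BStepS s2 s2' → BStepS (.comp s1 s2) (.comp s1 s2')
end

/-- The full λσ-reduction on terms: the union of `B` and the σ-rules. -/
def Step (t u : Tm) : Prop := BStep t u ∨ SStep t u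

/-- A term is in σ-normal form. -/
def SNormT (t : Tm) : Prop := ∀ u : Tm, ¬ SStep t u

/-- A substitution is in σ-normal form. -/
def SNormS (s : Sb) : Prop := ∀ s' : Sb, ¬ SStepS s s'

/-- `σ(t) = σ(u)` : the terms `t` and `u` have the same σ-normal form
(the σ-calculus being strongly normalizing and confluent, this is expressed
by the existence of a common σ-reduct in σ-normal form). -/
def EqSNF (t u : Tm) : Prop :=
  ∃ v : Tm, Relation.ReflTransGen SStep t v ∧
    Relation.ReflTransGen SStep u v ∧ SNormT v

mutual
/-- Potential redexability of terms: `prT t = true` iff `t` contains an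
application or a `λ` at some node. -/
def prT : Tm → Bool
  | .one => false
  | .app _ _ => true
  | .lam _ => true
  | .sub t s => prT t || prS s

/-- Potential redexability of substitutions. -/
def prS : Sb → Bool
  | .id => false
  | .shift => false
  | .cons t s => prT t || prS s
  | .comp s s' => prS s || prS s'
end

mutual
/-- The relation `≼` on terms. -/
inductive PrecT : Tm → Tm → Prop
  | idx (n m : ℕ) : PrecT (idx n) (idx m)
  | app {t t' u u' : Tm} : PrecT t t' → PrecT u u' → PrecT (.app t u) (.app t' u')
  | lam {t t' : Tm} : PrecT t t' → PrecT (.lam t) (.lam t')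
  | sub_r {t t' : Tm} {s : Sb} :
      PrecT t t' → prS s = false → PrecT t (.sub t' s)
  | sub {t t' : Tm} {s s' : Sb} :
      PrecT t t' → PrecS s s' → PrecT (.sub t s) (.sub t' s')

/-- The relation `≼` on substitutions. -/
inductive PrecS : Sb → Sb → Prop
  | shift : PrecS .shift .shift
  | id : PrecS .id .id
  | id_r {s : Sb} : prS s = false → PrecS .id s
  | cons {t t' : Tm} {s s' : Sb} :
      PrecT t t' → PrecS s s' → PrecS (.cons t s) (.cons t' s')
  | comp_r1 {s s' s1 : Sb} :
      PrecS s s' → prS s1 = false → PrecS s (.comp s' s1)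
  | comp_r2 {s s' s1 : Sb} :
      PrecS s s' → prS s1 = false → PrecS s (.comp s1 s')
  | comp {s1 s1' s2 s2' : Sb} :
      PrecS s1 s1' → PrecS s2 s2' → PrecS (.comp s1 s2) (.comp s1' s2')
end

/-- The relation `⋖` : `u ⋖ t` iff `u ≼ t` and `σ(u) = σ(t)`. -/
def Lessdot (u t : Tm) : Prop := PrecT u t ∧ EqSNF u t

/-- `⇑(s) = 1·(s∘↑)`. -/
def liftS (s : Sb) : Sb := .cons .one (.comp s .shift)

mutual
/-- Terms containing no `↑` (outside of de Bruijn indices, which are treated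
as atomic constants). -/
inductive NoShiftT : Tm → Prop
  | idx (n : ℕ) : NoShiftT (idx n)
  | app {t u : Tm} : NoShiftT t → NoShiftT u → NoShiftT (.app t u)
  | lam {t : Tm} : NoShiftT t → NoShiftT (.lam t)
  | sub {t : Tm} {s : Sb} : NoShiftT t → NoShiftS s → NoShiftT (.sub t s)

/-- Substitutions containing no `↑`. -/
inductive NoShiftS : Sb → Prop
  | id : NoShiftS .id
  | cons {t : Tm} {s : Sb} : NoShiftT t → NoShiftS s → NoShiftS (.cons t s)
  | comp {s s' : Sb} : NoShiftS s → NoShiftS s' → NoShiftS (.comp s s')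
end


/-- Pure de Bruijn λ-terms. -/
inductive Lam : Type
  | var : ℕ → Lam
  | app : Lam → Lam → Lam
  | lam : Lam → Lam

namespace Lam

/-- Lifting of a renaming under a binder. -/
def liftRen (ρ : ℕ → ℕ) : ℕ → ℕ
  | 0 => 0
  | k + 1 => ρ k + 1

/-- Renaming of variables. -/
def rename (ρ : ℕ → ℕ) : Lam → Lam
  | var k => var (ρ k)
  | app p q => app (rename ρ p) (rename ρ q)
  | lam p => lam (rename (liftRen ρ) p)

/-- Extension of a parallel substitution by a term for the first variable. -/
def scons (p : Lam) (σ : ℕ → Lam) : ℕ → Lam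
  | 0 => p
  | k + 1 => σ k

/-- Lifting of a parallel substitution under a binder. -/
def lift (σ : ℕ → Lam) : ℕ → Lam :=
  scons (var 0) fun k => rename Nat.succ (σ k)

/-- Parallel substitution. -/
def subst (σ : ℕ → Lam) : Lam → Lam
  | var k => σ k
  | app p q => app (subst σ p) (subst σ q)
  | lam p => lam (subst (lift σ) p)

theorem lift_var_comp (ρ : ℕ → ℕ) :
    lift (fun k => var (ρ k)) = fun k => var (liftRen ρ k) := by
  funext k; cases k <;> rfl

theorem subst_var_comp (p : Lam) (ρ : ℕ → ℕ) :
    subst (fun k => var (ρ k)) p = rename ρ p := by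
  induction p generalizing ρ with
  | var k => rfl
  | app p q hp hq => simp [subst, rename, hp, hq]
  | lam p hp => simp [subst, rename, lift_var_comp, hp]

theorem subst_rename (p : Lam) (ρ : ℕ → ℕ) (σ : ℕ → Lam) :
    subst σ (rename ρ p) = subst (fun k => σ (ρ k)) p := by
  induction p generalizing ρ σ with
  | var k => rfl
  | app p q hp hq => simp [subst, rename, hp, hq]
  | lam p hp =>
    simp only [subst, rename, hp]
    congr 2
    funext k; cases k <;> rfl

theorem rename_rename (p : Lam) (ρ ρ' : ℕ → ℕ) :
    rename ρ' (rename ρ p) = rename (fun k => ρ' (ρ k)) p := by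
  rw [← subst_var_comp, subst_rename, subst_var_comp]

theorem rename_subst (p : Lam) (σ : ℕ → Lam) (ρ : ℕ → ℕ) :
    rename ρ (subst σ p) = subst (fun k => rename ρ (σ k)) p := by
  induction p generalizing ρ σ with
  | var k => rfl
  | app p q hp hq => simp [subst, rename, hp, hq]
  | lam p hp =>
    simp only [subst, rename, hp]
    congr 2
    funext k
    cases k with
    | zero => rfl
    | succ k => simp only [lift, scons, rename_rename]; rfl

theorem subst_subst (p : Lam) (σ τ : ℕ → Lam) :
    subst τ (subst σ p) = subst (fun k => subst τ (σ k)) p := by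
  induction p generalizing σ τ with
  | var k => rfl
  | app p q hp hq => simp [subst, hp, hq]
  | lam p hp =>
    simp only [subst, hp]
    congr 2
    funext k
    cases k with
    | zero => rfl
    | succ k => simp only [lift, scons, subst_rename, rename_subst]

theorem lift_iterate_succ (i k : ℕ) :
    lift^[i] (fun k => var (k + 1)) k = var (if i ≤ k then k + 1 else k) := by
  induction i generalizing k with
  | zero => simp
  | succ i ih =>
    rw [Function.iterate_succ_apply']
    cases k with
    | zero => simp [lift, scons]
    | succ k =>
      simp only [lift, scons, ih, rename, Nat.add_le_add_iff_right]
      split <;> rfl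

end Lam

open Lam Relation

mutual
/-- The pure λ-term denoted by a λσ-term. -/
def evalT : Tm → Lam
  | .one => var 0
  | .app t u => .app (evalT t) (evalT u)
  | .lam t => .lam (evalT t)
  | .sub t s => subst (evalS s) (evalT t)

/-- The parallel substitution denoted by a λσ-substitution. -/
def evalS : Sb → ℕ → Lam
  | .id => var
  | .shift => fun k => var (k + 1)
  | .cons t s => scons (evalT t) (evalS s)
  | .comp s s' => fun k => subst (evalS s') (evalS s k)
end

/-- The σ-normal form of `↑ⁿ`. -/
def shiftPow : ℕ → Sb
  | 0 => .id
  | 1 => .shift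
  | n + 2 => .comp .shift (shiftPow (n + 1))

/-- The σ-normal λσ-term representing a pure λ-term. -/
def quote : Lam → Tm
  | .var 0 => .one
  | .var (k + 1) => .sub .one (shiftPow (k + 1))
  | .app p q => .app (quote p) (quote q)
  | .lam p => .lam (quote p)

/-- `NfS s σ`: the substitution `s` is a σ-normal form denoting `σ`. -/
inductive NfS : Sb → (ℕ → Lam) → Prop
  | shiftPow (n : ℕ) : NfS (shiftPow n) fun k => var (k + n)
  | cons (p : Lam) {s : Sb} {σ : ℕ → Lam} : NfS s σ → NfS (.cons (quote p) s) (scons p σ)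

theorem not_sstepS_shiftPow (n : ℕ) (s : Sb) : ¬ SStepS (shiftPow n) s := by
  induction n using shiftPow.induct generalizing s with
  | case1 => intro h; cases h
  | case2 => intro h; cases h
  | case3 n ih =>
    intro h
    rw [shiftPow] at h
    generalize hr : shiftPow (n + 1) = r at h ih
    cases h with
    | shiftid => cases n <;> simp [shiftPow] at hr
    | shiftcons => cases n <;> simp [shiftPow] at hr
    | compl h => cases h
    | compr h => exact ih _ h

theorem snormT_quote (p : Lam) : SNormT (quote p) := by
  induction p with
  | var k =>
    intro u h
    cases k with
    | zero => cases h
    | succ k =>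
      rw [quote] at h
      have hs := not_sstepS_shiftPow (k + 1)
      generalize hr : shiftPow (k + 1) = r at h hs
      cases h with
      | varid => cases k <;> simp [shiftPow] at hr
      | varcons => cases k <;> simp [shiftPow] at hr
      | subt h => cases h
      | subs h => exact hs _ h
  | app p q hp hq =>
    intro u h
    cases h with
    | appl h => exact hp _ h
    | appr h => exact hq _ h
  | lam p hp =>
    intro u h
    cases h with
    | lam h => exact hp _ h

theorem red_app {t t' u u' : Tm} (ht : ReflTransGen SStep t t') (hu : ReflTransGen SStep u u') :
    ReflTransGen SStep (.app t u) (.app t' u') :=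
  (ht.lift (Tm.app · u) fun _ _ => .appl).trans (hu.lift (Tm.app t') fun _ _ => .appr)

theorem red_lam {t t' : Tm} (ht : ReflTransGen SStep t t') :
    ReflTransGen SStep (.lam t) (.lam t') :=
  ht.lift Tm.lam fun _ _ => .lam

theorem red_sub {t t' : Tm} {s s' : Sb} (ht : ReflTransGen SStep t t')
    (hs : ReflTransGen SStepS s s') : ReflTransGen SStep (.sub t s) (.sub t' s') :=
  (ht.lift (Tm.sub · s) fun _ _ => .subt).trans (hs.lift (Tm.sub t') fun _ _ => .subs)

theorem red_cons {t t' : Tm} {s s' : Sb} (ht : ReflTransGen SStep t t')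
    (hs : ReflTransGen SStepS s s') : ReflTransGen SStepS (.cons t s) (.cons t' s') :=
  (ht.lift (Sb.cons · s) fun _ _ => .consl).trans (hs.lift (Sb.cons t') fun _ _ => .consr)

theorem red_comp {s₁ s₁' s₂ s₂' : Sb} (h₁ : ReflTransGen SStepS s₁ s₁')
    (h₂ : ReflTransGen SStepS s₂ s₂') : ReflTransGen SStepS (.comp s₁ s₂) (.comp s₁' s₂') :=
  (h₁.lift (Sb.comp · s₂) fun _ _ => .compl).trans (h₂.lift (Sb.comp s₁') fun _ _ => .compr)

theorem NfS.shift_comp {s : Sb} {σ : ℕ → Lam} (h : NfS s σ) :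
    ∃ r, ReflTransGen SStepS (.comp .shift s) r ∧ NfS r fun k => σ (k + 1) := by
  cases h with
  | shiftPow n =>
    have hn : NfS (LambdaSigma.shiftPow (n + 1)) fun k => var (k + 1 + n) := by
      simpa only [add_assoc, add_comm 1 n] using NfS.shiftPow (n + 1)
    cases n with
    | zero => exact ⟨_, .single .shiftid, hn⟩
    | succ n => exact ⟨_, .refl, hn⟩
  | cons p h => exact ⟨_, .single .shiftcons, h⟩

theorem NfS.shiftPow_comp {s : Sb} {σ : ℕ → Lam} (h : NfS s σ) (n : ℕ) :
    ∃ r, ReflTransGen SStepS (.comp (LambdaSigma.shiftPow n) s) r ∧ NfS r fun k => σ (k + n) := by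
  induction n using shiftPow.induct with
  | case1 => exact ⟨_, .single .idl, h⟩
  | case2 => exact h.shift_comp
  | case3 n ih =>
    obtain ⟨r, hr, hrσ⟩ := ih
    obtain ⟨r', hr', hrσ'⟩ := hrσ.shift_comp
    refine ⟨r', .head .assoc ((red_comp .refl hr).trans hr'), ?_⟩
    simp only [Nat.add_right_comm _ 1 (n + 1)] at hrσ'
    exact hrσ'

theorem NfS.red_one {s : Sb} {σ : ℕ → Lam} (h : NfS s σ) :
    ReflTransGen SStep (.sub .one s) (quote (σ 0)) := by
  cases h with
  | shiftPow n =>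
    simp only [Nat.zero_add]
    cases n with
    | zero => exact .single .varid
    | succ n => exact .refl
  | cons p h => exact .single .varcons

theorem NfS.red_var {s : Sb} {σ : ℕ → Lam} (h : NfS s σ) (k : ℕ) :
    ReflTransGen SStep (.sub (quote (var k)) s) (quote (σ k)) := by
  cases k with
  | zero => exact h.red_one
  | succ k =>
    obtain ⟨r, hr, hrσ⟩ := h.shiftPow_comp (k + 1)
    have h0 := hrσ.red_one
    rw [Nat.zero_add] at h0
    exact .head .clos ((red_sub .refl hr).trans h0)

theorem NfS.comp_of_red {s s' : Sb} {σ σ' : ℕ → Lam} (h : NfS s σ) (h' : NfS s' σ')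
    (H : ∀ k, ReflTransGen SStep (.sub (quote (σ k)) s') (quote (subst σ' (σ k)))) :
    ∃ r, ReflTransGen SStepS (.comp s s') r ∧ NfS r fun k => subst σ' (σ k) := by
  induction h with
  | shiftPow n => exact h'.shiftPow_comp n
  | @cons p s σ h ih =>
    obtain ⟨r, hr, hrσ⟩ := ih fun k => H (k + 1)
    refine ⟨_, .head .mapr (red_cons (H 0) hr), ?_⟩
    have hσ : (fun k => subst σ' (scons p σ k)) =
        scons (subst σ' p) fun k => subst σ' (σ k) :=
      funext fun k => by cases k <;> rfl
    exact hσ ▸ hrσ.cons _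

theorem NfS.liftS_of_red {s : Sb} {σ : ℕ → Lam} (h : NfS s σ)
    (H : ∀ k, ReflTransGen SStep (.sub (quote (σ k)) .shift) (quote (rename Nat.succ (σ k)))) :
    ∃ r, ReflTransGen SStepS (liftS s) r ∧ NfS r (lift σ) := by
  simp only [← subst_var_comp] at H
  obtain ⟨r, hr, hrσ⟩ := h.comp_of_red (NfS.shiftPow 1) H
  simp only [subst_var_comp] at hrσ
  exact ⟨_, red_cons .refl hr, hrσ.cons (var 0)⟩

theorem NfS.red_rename {s : Sb} {ρ : ℕ → ℕ} (h : NfS s fun k => var (ρ k)) (p : Lam) :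
    ReflTransGen SStep (.sub (quote p) s) (quote (rename ρ p)) := by
  induction p generalizing s ρ with
  | var k => exact h.red_var k
  | app p q hp hq => exact .head .app_s (red_app (hp h) (hq h))
  | lam p hp =>
    obtain ⟨r, hr, hrσ⟩ := h.liftS_of_red fun k => (NfS.shiftPow 1).red_var (ρ k)
    rw [lift_var_comp] at hrσ
    exact .head .lam_s (red_lam ((red_sub .refl hr).trans (hp hrσ)))

theorem NfS.red_subst {s : Sb} {σ : ℕ → Lam} (h : NfS s σ) (p : Lam) :
    ReflTransGen SStep (.sub (quote p) s) (quote (subst σ p)) := by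
  induction p generalizing s σ with
  | var k => exact h.red_var k
  | app p q hp hq => exact .head .app_s (red_app (hp h) (hq h))
  | lam p hp =>
    obtain ⟨r, hr, hrσ⟩ := h.liftS_of_red fun k => (NfS.shiftPow 1).red_rename (σ k)
    exact .head .lam_s (red_lam ((red_sub .refl hr).trans (hp hrσ)))

mutual
/-- Every term σ-reduces to the normal form of its denotation. -/
theorem red_quote_evalT : ∀ t : Tm, ReflTransGen SStep t (quote (evalT t))
  | .one => .refl
  | .app t u => red_app (red_quote_evalT t) (red_quote_evalT u)
  | .lam t => red_lam (red_quote_evalT t)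
  | .sub t s => by
    obtain ⟨r, hr, hrσ⟩ := red_nfS_evalS s
    exact (red_sub (red_quote_evalT t) hr).trans (hrσ.red_subst _)

/-- Every substitution σ-reduces to a normal form of its denotation. -/
theorem red_nfS_evalS : ∀ s : Sb, ∃ r, ReflTransGen SStepS s r ∧ NfS r (evalS s)
  | .id => ⟨_, .refl, NfS.shiftPow 0⟩
  | .shift => ⟨_, .refl, NfS.shiftPow 1⟩
  | .cons t s => by
    obtain ⟨r, hr, hrσ⟩ := red_nfS_evalS s
    exact ⟨_, red_cons (red_quote_evalT t) hr, hrσ.cons _⟩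
  | .comp s s' => by
    obtain ⟨r, hr, hrσ⟩ := red_nfS_evalS s
    obtain ⟨r', hr', hrσ'⟩ := red_nfS_evalS s'
    obtain ⟨q, hq, hqσ⟩ := hrσ.comp_of_red hrσ' fun k => hrσ'.red_subst _
    exact ⟨q, (red_comp hr hr').trans hq, hqσ⟩
end

/-- Terms with the same denotation have the same σ-normal form. -/
theorem eqSNF_of_evalT_eq {t u : Tm} (h : evalT t = evalT u) : EqSNF t u :=
  ⟨quote (evalT t), red_quote_evalT t, h ▸ red_quote_evalT u, snormT_quote _⟩

theorem evalS_liftS_iterate (s : Sb) (i : ℕ) : evalS (liftS^[i] s) = lift^[i] (evalS s) := by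
  induction i with
  | zero => rfl
  | succ i ih =>
    rw [Function.iterate_succ_apply', Function.iterate_succ_apply', ← ih]
    funext k
    cases k with
    | zero => rfl
    | succ k => exact subst_var_comp _ _

theorem toIdx?_idx (k : ℕ) : toIdx? (idx k) = some k := by
  induction k with
  | zero => rfl
  | succ k ih => simp [idx, toIdx?, ih]

theorem evalT_idx (k : ℕ) : evalT (idx k) = var k := by
  induction k with
  | zero => rfl
  | succ k ih => simp [idx, evalT, evalS, ih, subst]

theorem upT_idx (i j k : ℕ) : upT i j (idx k) = if i ≤ k then idx (k + j) else idx k := by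
  cases k with
  | zero =>
    rcases Nat.eq_zero_or_pos i with rfl | hi
    · simp [idx, upT]
    · simp [idx, upT, hi, hi.ne']
  | succ k =>
    have h := toIdx?_idx (k + 1)
    rw [idx] at h
    rw [idx, upT, h]
    rfl

theorem NoShiftS.toIdx?_sub {s : Sb} (h : NoShiftS s) (t : Tm) : toIdx? (.sub t s) = none := by
  cases h <;> simp [toIdx?]

mutual
theorem NoShiftT.evalT_upT : ∀ {t : Tm}, NoShiftT t → ∀ i : ℕ,
    evalT (upT i 1 t) = subst (lift^[i] fun k => var (k + 1)) (evalT t)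
  | _, .idx n, i => by
    rw [upT_idx, evalT_idx, subst, lift_iterate_succ]
    split <;> exact evalT_idx _
  | _, .app ht hu, i => by
    simp only [upT, evalT, subst, ht.evalT_upT i, hu.evalT_upT i]
  | _, .lam ht, i => by
    simp only [upT, evalT, subst, ht.evalT_upT (i + 1), Function.iterate_succ_apply']
  | _, .sub ht hs, i => by
    simp only [upT, hs.toIdx?_sub, evalT, ht.evalT_upT, subst_subst, hs.evalS_upS]

theorem NoShiftS.evalS_upS : ∀ {s : Sb}, NoShiftS s → ∀ i k : ℕ,
    subst (evalS (upS i 1 s).2) (lift^[(upS i 1 s).1] (fun k => var (k + 1)) k) =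
      subst (lift^[i] fun k => var (k + 1)) (evalS s k)
  | _, .id, i, k => by
    simp only [upS, evalS, lift_iterate_succ, subst]
  | _, .cons ht hs, i, k => by
    simp only [upS, evalS, Function.iterate_succ_apply']
    cases k with
    | zero => exact ht.evalT_upT i
    | succ k =>
      simp only [lift, scons, subst_rename]
      exact hs.evalS_upS i k
  | .comp _ s', .comp hs hs', i, k => by
    have h' := hs'.evalS_upS i
    have h := hs.evalS_upS (upS i 1 s').1 k
    simp only [upS, evalS]
    rw [← subst_subst, h, subst_subst, subst_subst]
    simp only [h']
end

/-- For every λσ-term `t` containing no `↑`, the σ-normal form of `⇑₀¹(t)`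
equals the σ-normal form of `t[↑]`; more generally, for every `i`,
`σ(⇑ᵢ¹(t)) = σ(t[⇑ⁱ(↑)])` where `⇑(s) = 1·(s∘↑)`. -/
theorem upT_shift_snf (t : Tm) (ht : NoShiftT t) :
    EqSNF (upT 0 1 t) (.sub t .shift) ∧
    ∀ i : ℕ, EqSNF (upT i 1 t) (.sub t (liftS^[i] .shift)) := by
  have h (i : ℕ) : EqSNF (upT i 1 t) (.sub t (liftS^[i] .shift)) := by
    apply eqSNF_of_evalT_eq
    rw [ht.evalT_upT, evalT, evalS_liftS_iterate]
    rfl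
  exact ⟨h 0, h⟩

end LambdaSigma
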